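/- arXiv:1506.01092 — 2 statements merged into one kernel-verified Lean document; each statement's English description precedes it below -/
import Mathlib

section
/- Let d_w, d_v be positive integers and let X, Y be real d_w × d_v matrices with ‖X‖_F ≤ 0.8 and ‖Y‖_F ≤ 0.8, and suppose the eigenvalues λ_1 ≥ λ_2 ≥ … ≥ λ_{d_w} ≥ 0 of Δ = (X−Y)(X−Y)ᵀ satisfy λ_1 ≤ 0.28·Σ_{i=2}^{d_w} λ_i. Then P(h(X) ≠ h(Y)) ≥ (4/π²)·(1 − κ_g(X−Y)^{0.79}), where the probability is over (w, v, b, t). -/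
open MeasureTheory ProbabilityTheory Matrix Real

/-- Standard Gaussian measure on ℝ^d (i.i.d. N(0,1) entries). -/
noncomputable def stdGaussian (d : ℕ) : Measure (Fin d → ℝ) :=
  Measure.pi fun _ => ProbabilityTheory.gaussianReal 0 1

/-- Uniform probability measure on the interval [a, b]. -/
noncomputable def unifIcc (a b : ℝ) : Measure ℝ :=
  (ENNReal.ofReal (b - a))⁻¹ • MeasureTheory.volume.restrict (Set.Icc a b)

/-- κ_b(A) = det(I + A Aᵀ)^(−1/2). -/
noncomputable def kb {dw dv : ℕ} (A : Matrix (Fin dw) (Fin dv) ℝ) : ℝ :=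
  (Matrix.det (1 + A * Aᵀ)) ^ (-(1 / 2 : ℝ))

/-- Gaussian kernel κ_g(A) = exp(−‖A‖_F²/2). -/
noncomputable def kg {dw dv : ℕ} (A : Matrix (Fin dw) (Fin dv) ℝ) : ℝ :=
  Real.exp (-(∑ i, ∑ j, (A i j) ^ 2) / 2)

/-- Binary quantizer sgn(z) = 1 if z ≥ 0, else 0. -/
noncomputable def sgn01 (z : ℝ) : ℝ := if 0 ≤ z then 1 else 0

/-- Joint law of (w, v, b, t): w ~ N(0, I_{d_w}), v ~ N(0, I_{d_v}),
b ~ Unif[0, 2π], t ~ Unif[−1, 1], mutually independent. -/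
noncomputable def hashLaw (dw dv : ℕ) :
    Measure ((Fin dw → ℝ) × (Fin dv → ℝ) × ℝ × ℝ) :=
  (stdGaussian dw).prod ((stdGaussian dv).prod ((unifIcc 0 (2 * π)).prod (unifIcc (-1) 1)))

/-- The hash bit h(X) = sgn(cos(wᵀ X v + b) + t) as a function of (w, v, b, t). -/
noncomputable def hashBit {dw dv : ℕ} (X : Matrix (Fin dw) (Fin dv) ℝ)
    (p : (Fin dw → ℝ) × (Fin dv → ℝ) × ℝ × ℝ) : ℝ :=
  sgn01 (Real.cos (p.1 ⬝ᵥ (X *ᵥ p.2.1) + p.2.2.1) + p.2.2.2)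


lemma aux_coeff (n : ℤ) : ∫ x in (0:ℝ)..1, Complex.exp (2 * π * Complex.I * ((-n : ℤ) : ℂ) * x / (1:ℝ)) * ((|Real.sin (π * x)| : ℝ) : ℂ)
    = ((2 / (π * (1 - 4 * (n:ℝ)^2)) : ℝ) : ℂ) := by
  have hpi : (π : ℂ) ≠ 0 := by exact_mod_cast Real.pi_ne_zero
  have hne : (1 - 4 * (n:ℂ)^2) ≠ 0 := by
    have : (1 - 4 * n^2 : ℤ) ≠ 0 := by omega
    exact_mod_cast this
  set c : ℂ := -(2 * π * Complex.I * n) with hc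
  have hc2 : c ^ 2 + π ^ 2 = π ^ 2 * (1 - 4 * (n:ℂ)^2) := by
    rw [hc]; ring_nf; rw [Complex.I_sq]; ring
  have hc3 : c ^ 2 + π ^ 2 ≠ 0 := by rw [hc2]; positivity
  have h1 : ∫ x in (0:ℝ)..1, Complex.exp (2 * π * Complex.I * ((-n : ℤ) : ℂ) * x / (1:ℝ)) * ((|Real.sin (π * x)| : ℝ) : ℂ)
     = ∫ x in (0:ℝ)..1, Complex.exp (c * x) * Complex.sin (π * x) := by
    apply intervalIntegral.integral_congr
    intro x hx
    rw [Set.uIcc_of_le zero_le_one] at hx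
    have : 0 ≤ Real.sin (π * x) := Real.sin_nonneg_of_nonneg_of_le_pi (by have := hx.1; positivity)
      (by nlinarith [hx.2, Real.pi_pos])
    simp only
    rw [abs_of_nonneg this, hc]
    push_cast
    congr 2
    ring
  rw [h1]
  have hd : ∀ x ∈ Set.uIcc (0:ℝ) 1, HasDerivAt (fun x : ℝ => Complex.exp (c * x) * (c * Complex.sin (π * x) - π * Complex.cos (π * x)) / (c^2 + π^2)) (Complex.exp (c * x) * Complex.sin (π * x)) x := by
    intro x _
    have e0 : HasDerivAt (fun y : ℝ => (y : ℂ)) 1 x := Complex.ofRealCLM.hasDerivAt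
    have e1 := (e0.const_mul c).cexp
    have e2 := (Complex.hasDerivAt_sin (π * x)).comp x (e0.const_mul (π:ℂ))
    have e3 := (Complex.hasDerivAt_cos (π * x)).comp x (e0.const_mul (π:ℂ))
    have := (e1.mul ((e2.const_mul c).sub (e3.const_mul (π:ℂ)))).div_const (c^2 + π^2)
    refine this.congr_deriv ?_
    rw [div_eq_iff hc3]
    simp only [Pi.sub_apply, Function.comp]
    ring
  rw [intervalIntegral.integral_eq_sub_of_hasDerivAt hd (by apply Continuous.intervalIntegrable; fun_prop)]
  have he : Complex.exp c = 1 := by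
    rw [hc, Complex.exp_eq_one_iff]; exact ⟨-n, by push_cast; ring⟩
  simp [he]
  rw [hc2]
  field_simp
  ring

lemma aux_fourier (θ : ℝ) : HasSum (fun n : ℤ => (2 / (π * (4 * (n:ℝ)^2 - 1))) * (1 - Real.cos (n * θ))) |Real.sin (θ / 2)| := by
  have : Fact ((0:ℝ) < 1) := ⟨one_pos⟩
  have hper : Function.Periodic (fun x : ℝ => ((|Real.sin (π * x)| : ℝ) : ℂ)) 1 := by
    intro x; simp [mul_add, Real.sin_add_pi]
  let f : C(AddCircle (1:ℝ), ℂ) := ⟨hper.lift, by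
    apply continuous_quot_lift; fun_prop⟩
  have hf : ∀ x : ℝ, f (x : AddCircle (1:ℝ)) = ((|Real.sin (π * x)| : ℝ) : ℂ) := fun x => rfl
  have hcoef : fourierCoeff f = fun n : ℤ => ((2 / (π * (1 - 4 * (n:ℝ)^2)) : ℝ) : ℂ) := by
    funext n
    rw [fourierCoeff_eq_intervalIntegral f n 0, ← aux_coeff n]
    rw [zero_add, div_one, one_smul]
    apply intervalIntegral.integral_congr
    intro x _
    simp only [hf, fourier_coe_apply, smul_eq_mul]
  have hsum : Summable (fourierCoeff f) := by
    rw [hcoef]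
    apply Complex.summable_ofReal.2 
    refine Summable.of_norm_bounded_eventually (g := fun n : ℤ => 1 / (n:ℝ)^2) (Real.summable_one_div_int_pow.2 (by norm_num)) ?_
    have : ∀ᶠ n : ℤ in Filter.cofinite, n ≠ 0 := by
      refine (Set.finite_singleton (0:ℤ)).subset ?_
      intro x hx; simpa using hx
    filter_upwards [this] with n hn
    have h1 : (1:ℝ) ≤ (n:ℝ)^2 := by
      have : 1 ≤ n^2 := by have := sq_pos_of_ne_zero hn; omega
      exact_mod_cast this
    rw [Real.norm_eq_abs, abs_div, abs_mul, abs_of_pos Real.pi_pos, abs_of_neg (show 1 - 4 * (n:ℝ)^2 < 0 by linarith), abs_of_pos (by norm_num : (0:ℝ) < 2)]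
    rw [div_le_div_iff₀ (by have := Real.pi_pos; apply mul_pos this; linarith) (by linarith)]
    nlinarith [Real.pi_gt_three]
  have hp := has_pointwise_sum_fourier_series_of_summable hsum
  have h0 := hp ((0:ℝ) : AddCircle (1:ℝ))
  have h1 := hp ((θ / (2 * π) : ℝ) : AddCircle (1:ℝ))
  have h2 := Complex.hasSum_re (h1.sub h0)
  have hpi := Real.pi_ne_zero
  simp only [hf, hcoef, fourier_coe_apply] at h2
  convert h2 using 1
  · funext n
    have : (2 * π * Complex.I * n * ((θ / (2 * π) : ℝ) : ℂ) / ((1:ℝ):ℂ)) = ((n * θ : ℝ) : ℂ) * Complex.I := by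
      have : (π : ℂ) ≠ 0 := by exact_mod_cast hpi
      push_cast; field_simp
    rw [this]
    simp only [smul_eq_mul, Complex.sub_re, Complex.re_ofReal_mul, Complex.exp_ofReal_mul_I_re]
    simp
    rw [← neg_sub (4 * (n:ℝ)^2) 1, mul_neg, div_neg]
    ring
  · simp
    congr 2
    field_simp

lemma aux_lower (θ : ℝ) (N : ℕ) : ∑ m ∈ Finset.range N, (4 / (π * (4 * ((m:ℝ)+1)^2 - 1))) * (1 - Real.cos ((m+1) * θ)) ≤ |Real.sin (θ / 2)| := by
  have h := (aux_fourier θ).nat_add_neg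
  have h' := (hasSum_nat_add_iff' 1).2 h
  simp at h'
  refine le_trans (le_of_eq ?_) (sum_le_hasSum (Finset.range N) ?_ h')
  · apply Finset.sum_congr rfl
    intro m _
    rw [show (-1 + -(m:ℝ)) * θ = - ((m+1)*θ) by ring, Real.cos_neg]
    ring
  · intro m _
    rw [show (-1 + -(m:ℝ)) * θ = - ((m+1)*θ) by ring, Real.cos_neg]
    have h1 := Real.cos_le_one ((m+1)*θ)
    have : (0:ℝ) ≤ m := by positivity
    have h2 : 0 < 4 * ((m:ℝ)+1)^2 - 1 := by nlinarith
    have h3 : 0 < 4 * (-1 + -(m:ℝ))^2 - 1 := by nlinarith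
    have h4 : 0 ≤ 1 - cos ((m+1)*θ) := by linarith
    positivity

lemma log_aux (x : ℝ) (h0 : 0 ≤ x) (h1 : x ≤ 0.56) : Real.exp (0.79 * x) ≤ 1 + x := by
  have hb : Real.exp (0.79 * 0.56) ≤ 1.56 := by
    have h := Real.exp_bound' (x := 0.79 * 0.56) (by norm_num) (by norm_num) (n := 6) (by norm_num)
    refine h.trans ?_
    norm_num [Finset.sum_range_succ, Nat.factorial]
  have hc := convexOn_exp.2 (Set.mem_univ (0:ℝ)) (Set.mem_univ (0.79 * 0.56 : ℝ)) (show 0 ≤ 1 - x / 0.56 by rw [sub_nonneg, div_le_one (by norm_num)]; exact h1) (show 0 ≤ x / 0.56 by positivity) (by ring)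
  simp only [smul_eq_mul, Real.exp_zero] at hc
  rw [show (1 - x / 0.56) * 0 + x / 0.56 * (0.79 * 0.56) = 0.79 * x by ring] at hc
  have : 0 ≤ x / 0.56 := by positivity
  have h2 := mul_le_mul_of_nonneg_left hb this
  have h3 : x / 0.56 * 1.56 = x / 0.56 + x := by ring
  linarith

lemma gauss1 (l : ℝ) (hl : 0 ≤ l) : ∫ x, Real.exp (-(l * x^2) / 2) ∂(gaussianReal 0 1) = (√(1 + l))⁻¹ := by
  rw [integral_gaussianReal_eq_integral_smul one_ne_zero]
  simp only [gaussianPDFReal, smul_eq_mul]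
  have : ∀ x : ℝ, (√(2 * π * ((1:NNReal):ℝ)))⁻¹ * rexp (-(x - 0) ^ 2 / (2 * ((1:NNReal):ℝ))) * rexp (-(l * x ^ 2) / 2) = (√(2 * π))⁻¹ * rexp (-((1 + l)/2) * x^2) := by
    intro x
    rw [mul_assoc, ← Real.exp_add]
    rw [NNReal.coe_one, mul_one, mul_one]
    congr 2
    ring
  simp_rw [this]
  rw [integral_const_mul, integral_gaussian, ← Real.sqrt_inv, ← Real.sqrt_inv, ← Real.sqrt_mul (by positivity)]
  congr 1
  have := Real.pi_pos
  field_simp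

instance (d : ℕ) : IsProbabilityMeasure (_root_.stdGaussian d) := by
  unfold _root_.stdGaussian; infer_instance

lemma gaussCos (d : ℕ) (a : Fin d → ℝ) : ∫ v, Real.cos (a ⬝ᵥ v) ∂(_root_.stdGaussian d) = Real.exp (-(∑ i, a i ^ 2) / 2) := by
  have h : ∫ v, Complex.exp ((a ⬝ᵥ v : ℝ) * Complex.I) ∂(_root_.stdGaussian d) = Complex.exp (((-(∑ i, a i ^ 2) / 2 : ℝ)) : ℂ) := by
    have : ∀ v : Fin d → ℝ, Complex.exp ((a ⬝ᵥ v : ℝ) * Complex.I) = ∏ i, Complex.exp (a i * v i * Complex.I) := by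
      intro v
      rw [← Complex.exp_sum, dotProduct]; push_cast; rw [Finset.sum_mul]
    simp_rw [this]
    unfold _root_.stdGaussian
    rw [integral_fintype_prod_eq_prod (fun i (x : ℝ) => Complex.exp (a i * x * Complex.I))]
    simp_rw [← charFun_apply_real, charFun_gaussianReal]
    rw [← Complex.exp_sum]
    congr 1
    push_cast
    rw [neg_div, Finset.sum_div, ← Finset.sum_neg_distrib]
    simp
  have h2 := congrArg Complex.re h
  rw [← Complex.ofReal_exp, Complex.ofReal_re] at h2
  rw [← h2, ← RCLike.re_eq_complex_re, ← integral_re]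
  · simp [Complex.exp_ofReal_mul_I_re]
  · refine Integrable.of_bound (C := 1) (by apply Continuous.aestronglyMeasurable; unfold dotProduct; fun_prop) (.of_forall fun v => ?_)
    rw [Complex.norm_exp_ofReal_mul_I]

lemma gaussQuad {d e : ℕ} (A : Matrix (Fin d) (Fin e) ℝ) (h : (A * Aᵀ).IsHermitian) (hn : ∀ i, 0 ≤ h.eigenvalues i) :
    ∫ w, Real.exp (-(∑ j, (w ᵥ* A) j ^ 2) / 2) ∂(_root_.stdGaussian d) = ∏ i, (√(1 + h.eigenvalues i))⁻¹ := by
  let F : EuclideanSpace ℝ (Fin d) → ℝ := fun x => Real.exp (-(∑ j, (x.ofLp ᵥ* A) j ^ 2) / 2)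
  have hF : Continuous F := by
    have : ∀ j, Continuous fun x : EuclideanSpace ℝ (Fin d) => (x.ofLp ᵥ* A) j := by
      intro j; unfold vecMul dotProduct; fun_prop
    fun_prop
  have e1 : ∫ w, Real.exp (-(∑ j, (w ᵥ* A) j ^ 2) / 2) ∂(_root_.stdGaussian d) = ∫ x, F x ∂(ProbabilityTheory.stdGaussian (EuclideanSpace ℝ (Fin d))) := by
    rw [← map_pi_eq_stdGaussian, integral_map (by fun_prop) hF.aestronglyMeasurable]
    rfl
  rw [e1, stdGaussian_eq_map_pi_orthonormalBasis h.eigenvectorBasis, integral_map (Continuous.aemeasurable (by fun_prop)) hF.aestronglyMeasurable]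
  have key : ∀ z : Fin d → ℝ, F (∑ i, z i • h.eigenvectorBasis i) = ∏ i, Real.exp (-(h.eigenvalues i * z i ^ 2) / 2) := by
    intro z
    rw [← Real.exp_sum]
    simp only [F]
    congr 1
    rw [← Finset.sum_div, Finset.sum_neg_distrib]
    congr 2
    set x := ∑ i, z i • h.eigenvectorBasis i with hx
    have a1 : ∑ j, (x.ofLp ᵥ* A) j ^ 2 = x.ofLp ⬝ᵥ ((A * Aᵀ) *ᵥ x.ofLp) := by
      rw [← mulVec_mulVec, dotProduct_mulVec, mulVec_transpose, dotProduct]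
      simp [sq]
    have a2 : (A * Aᵀ) *ᵥ x.ofLp = (∑ i, (h.eigenvalues i * z i) • h.eigenvectorBasis i).ofLp := by
      rw [hx]
      simp only [WithLp.ofLp_sum, WithLp.ofLp_smul, mulVec_sum, mulVec_smul, h.mulVec_eigenvectorBasis]
      refine Finset.sum_congr rfl fun i _ => ?_
      simp [smul_smul, mul_comm]
    have a3 : x.ofLp ⬝ᵥ (∑ i, (h.eigenvalues i * z i) • h.eigenvectorBasis i).ofLp = inner ℝ x (∑ i, (h.eigenvalues i * z i) • h.eigenvectorBasis i) := by
      rw [EuclideanSpace.inner_eq_star_dotProduct, dotProduct_comm]; simp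
    rw [a1, a2, a3, hx, h.eigenvectorBasis.orthonormal.inner_sum]
    refine Finset.sum_congr rfl fun i _ => ?_
    simp; ring
  simp_rw [key]
  rw [integral_fintype_prod_eq_prod (fun i (x : ℝ) => Real.exp (-(h.eigenvalues i * x ^ 2) / 2))]
  exact Finset.prod_congr rfl fun i _ => gauss1 _ (hn i)

lemma slice_t (c1 c2 : ℝ) (h1 : |c1| ≤ 1) (h2 : |c2| ≤ 1) :
    unifIcc (-1) 1 {t | sgn01 (c1 + t) ≠ sgn01 (c2 + t)} = ENNReal.ofReal (|c1 - c2| / 2) := by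
  wlog h : c1 ≤ c2 generalizing c1 c2
  · rw [abs_sub_comm, ← this c2 c1 h2 h1 (by linarith)]
    simp_rw [ne_comm]
  rw [abs_le] at h1 h2
  have hs : {t | sgn01 (c1 + t) ≠ sgn01 (c2 + t)} = Set.Ico (-c2) (-c1) := by
    ext t
    simp only [Set.mem_ofPred_eq, Set.mem_Ico, sgn01]
    by_cases a : 0 ≤ c1 + t
    · have b : 0 ≤ c2 + t := by linarith
      simp [a, b]; intro; linarith
    · by_cases b : 0 ≤ c2 + t
      · simp [a, b]; constructor <;> linarith
      · simp [a, b]; intro; linarith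
  rw [hs, unifIcc, Measure.smul_apply, Measure.restrict_apply measurableSet_Ico,
    Set.inter_eq_left.2 (show Set.Ico (-c2) (-c1) ⊆ Set.Icc (-1) 1 from
      fun t ht => ⟨by linarith [ht.1], by linarith [ht.2]⟩), Real.volume_Ico,
    smul_eq_mul, ← ENNReal.ofReal_inv_of_pos (by norm_num), ← ENNReal.ofReal_mul (by norm_num),
    abs_of_nonpos (by linarith)]
  congr 1
  ring

lemma int_abs_sin (g : ℝ) : ∫ b in (0:ℝ)..(2*π), |Real.sin (b + g)| = 4 := by
  have hper : Function.Periodic (fun x => |Real.sin x|) π := by intro x; simp [Real.sin_add_pi]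
  have hper2 : Function.Periodic (fun x => |Real.sin x|) (2*π) := by intro x; simp
  have e : ∫ b in (0:ℝ)..π, |Real.sin b| = 2 := by
    have : ∫ b in (0:ℝ)..π, |Real.sin b| = ∫ b in (0:ℝ)..π, Real.sin b := by
      apply intervalIntegral.integral_congr
      intro x hx
      rw [Set.uIcc_of_le Real.pi_pos.le] at hx
      exact abs_of_nonneg (Real.sin_nonneg_of_nonneg_of_le_pi hx.1 hx.2)
    rw [this, integral_sin]
    norm_num
  rw [intervalIntegral.integral_comp_add_right (fun x => |Real.sin x|)]
  rw [show 2 * π + g = (0 + g) + 2 * π by ring, hper2.intervalIntegral_add_eq (0+g) 0]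
  have hi : ∀ a b, IntervalIntegrable (fun x => |Real.sin x|) volume a b := fun a b =>
    Continuous.intervalIntegrable (by fun_prop) a b
  rw [← intervalIntegral.integral_add_adjacent_intervals (hi 0 π) (hi π _)]
  rw [show (0:ℝ) + 2 * π = π + π by ring, hper.intervalIntegral_add_eq π 0, zero_add, e]
  norm_num

lemma sgn_meas : Measurable sgn01 := by
  unfold sgn01
  exact Measurable.ite measurableSet_Ici measurable_const measurable_const

instance : IsProbabilityMeasure (unifIcc (-1) 1) := ⟨by
  simp [unifIcc]; 
  rw [show (1:ℝ)+1 = 2 by norm_num]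
  apply ENNReal.inv_mul_cancel <;> simp⟩

instance : IsProbabilityMeasure (unifIcc 0 (2*π)) := ⟨by
  simp [unifIcc]
  apply ENNReal.inv_mul_cancel <;> simp [Real.pi_pos, ENNReal.mul_eq_top]⟩

lemma slice_bt (α β : ℝ) :
    ((unifIcc 0 (2 * π)).prod (unifIcc (-1) 1)) {p | sgn01 (Real.cos (α + p.1) + p.2) ≠ sgn01 (Real.cos (β + p.1) + p.2)}
      = ENNReal.ofReal (2 / π * |Real.sin ((α - β) / 2)|) := by
  have hm : MeasurableSet {p : ℝ × ℝ | sgn01 (Real.cos (α + p.1) + p.2) ≠ sgn01 (Real.cos (β + p.1) + p.2)} := by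
    refine (measurableSet_eq_fun (sgn_meas.comp (by fun_prop)) (sgn_meas.comp (by fun_prop))).compl
  rw [Measure.prod_apply hm]
  have : ∀ b : ℝ, unifIcc (-1) 1 (Prod.mk b ⁻¹' {p : ℝ × ℝ | sgn01 (Real.cos (α + p.1) + p.2) ≠ sgn01 (Real.cos (β + p.1) + p.2)}) = ENNReal.ofReal (|Real.sin ((α - β) / 2)| * |Real.sin (b + (α + β)/2)|) := by
    intro b
    have hs : (Prod.mk b ⁻¹' {p : ℝ × ℝ | sgn01 (Real.cos (α + p.1) + p.2) ≠ sgn01 (Real.cos (β + p.1) + p.2)}) = {t | sgn01 (Real.cos (α + b) + t) ≠ sgn01 (Real.cos (β + b) + t)} := by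
      ext t; simp
    rw [hs, slice_t _ _ (Real.abs_cos_le_one _) (Real.abs_cos_le_one _)]
    rw [Real.cos_sub_cos, abs_mul, abs_mul]
    congr 1
    rw [show (α + b + (β + b)) / 2 = b + (α + β)/2 by ring, show (α + b - (β + b)) / 2 = (α - β)/2 by ring]
    norm_num; ring
  simp_rw [this]
  rw [unifIcc, lintegral_smul_measure, ← ofReal_integral_eq_lintegral_ofReal]
  · rw [integral_const_mul, integral_Icc_eq_integral_Ioc, ← intervalIntegral.integral_of_le (by positivity), int_abs_sin]
    rw [smul_eq_mul, ← ENNReal.ofReal_inv_of_pos (by simp [Real.pi_pos]), ← ENNReal.ofReal_mul (by simp [Real.pi_pos.le])]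
    congr 1
    have := Real.pi_pos
    field_simp
    ring
  · exact (Continuous.integrableOn_Icc (by fun_prop))
  · exact .of_forall fun b => by positivity

lemma vecMul_cont {d e : ℕ} (A : Matrix (Fin d) (Fin e) ℝ) (j : Fin e) :
    Continuous fun w : Fin d → ℝ => (w ᵥ* A) j := by
  unfold vecMul dotProduct; fun_prop

lemma bil_cont {d e : ℕ} (A : Matrix (Fin d) (Fin e) ℝ) :
    Continuous fun p : (Fin d → ℝ) × (Fin e → ℝ) => p.1 ⬝ᵥ (A *ᵥ p.2) := by
  unfold mulVec dotProduct; fun_prop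

lemma hashLaw_diff_eq {dw dv : ℕ} (X Y : Matrix (Fin dw) (Fin dv) ℝ) :
    (hashLaw dw dv {p | hashBit X p ≠ hashBit Y p}).toReal =
      ∫ p, 2 / π * |Real.sin ((p.1 ⬝ᵥ ((X - Y) *ᵥ p.2)) / 2)| ∂((_root_.stdGaussian dw).prod (_root_.stdGaussian dv)) := by
  have hc (Z : Matrix (Fin dw) (Fin dv) ℝ) : Measurable (hashBit Z) := by
    unfold hashBit
    refine sgn_meas.comp (Continuous.measurable ?_)
    have := (bil_cont Z).comp (show Continuous fun p : (Fin dw → ℝ) × (Fin dv → ℝ) × ℝ × ℝ => (p.1, p.2.1) by fun_prop)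
    simp only [Function.comp_def] at this
    fun_prop
  have hS : MeasurableSet {p | hashBit X p ≠ hashBit Y p} := (measurableSet_eq_fun (hc X) (hc Y)).compl
  have hgc : Continuous fun p : (Fin dw → ℝ) × (Fin dv → ℝ) => 2 / π * |Real.sin ((p.1 ⬝ᵥ ((X - Y) *ᵥ p.2)) / 2)| := by
    have := bil_cont (X - Y)
    fun_prop
  have hnn : ∀ p : (Fin dw → ℝ) × (Fin dv → ℝ), 0 ≤ 2 / π * |Real.sin ((p.1 ⬝ᵥ ((X - Y) *ᵥ p.2)) / 2)| := by
    intro p; have := Real.pi_pos; positivity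
  rw [integral_eq_lintegral_of_nonneg_ae (.of_forall hnn) hgc.aestronglyMeasurable]
  congr 1
  rw [lintegral_prod _ (by fun_prop), hashLaw, Measure.prod_apply hS]
  refine lintegral_congr fun w => ?_
  rw [Measure.prod_apply (measurable_prodMk_left hS)]
  refine lintegral_congr fun v => ?_
  have hs : (Prod.mk v ⁻¹' (Prod.mk w ⁻¹' {p | hashBit X p ≠ hashBit Y p})) =
      {p : ℝ × ℝ | sgn01 (Real.cos (w ⬝ᵥ (X *ᵥ v) + p.1) + p.2) ≠ sgn01 (Real.cos (w ⬝ᵥ (Y *ᵥ v) + p.1) + p.2)} := by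
    ext p; simp [hashBit]
  rw [hs, slice_bt, sub_mulVec, dotProduct_sub]

lemma cos_bound {dw dv : ℕ} (A : Matrix (Fin dw) (Fin dv) ℝ) (h : (A * Aᵀ).IsHermitian)
    (hn : ∀ i, 0 ≤ h.eigenvalues i) (m : ℝ) (hm : 1 ≤ m) :
    ∫ p, Real.cos (m * (p.1 ⬝ᵥ (A *ᵥ p.2))) ∂((_root_.stdGaussian dw).prod (_root_.stdGaussian dv))
      ≤ ∏ i, (√(1 + h.eigenvalues i))⁻¹ := by
  have hb := bil_cont A
  rw [integral_prod _ (Integrable.of_bound (C := 1) (Continuous.aestronglyMeasurable (by fun_prop))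
    (.of_forall fun v => Real.abs_cos_le_one _))]
  have e : ∀ w : Fin dw → ℝ, ∫ v, Real.cos (m * (w ⬝ᵥ (A *ᵥ v))) ∂(_root_.stdGaussian dv) =
      Real.exp (-(m ^ 2 * ∑ j, (w ᵥ* A) j ^ 2) / 2) := by
    intro w
    have : ∀ v, m * (w ⬝ᵥ (A *ᵥ v)) = (m • (w ᵥ* A)) ⬝ᵥ v := by
      intro v; rw [dotProduct_mulVec, smul_dotProduct, smul_eq_mul]
    simp_rw [this]
    rw [gaussCos]
    simp [mul_pow, Finset.mul_sum]
  simp only [e]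
  rw [← gaussQuad A h hn]
  have hv := vecMul_cont A
  have hi : ∀ c : ℝ, 0 ≤ c → Integrable (fun w => Real.exp (-(c * ∑ j, (w ᵥ* A) j ^ 2) / 2)) (_root_.stdGaussian dw) := by
    intro c hc
    refine Integrable.of_bound (C := 1) (Continuous.aestronglyMeasurable (by fun_prop)) (.of_forall fun v => ?_)
    rw [Real.norm_eq_abs, Real.abs_exp, Real.exp_le_one_iff]
    have : 0 ≤ ∑ j, (v ᵥ* A) j ^ 2 := Finset.sum_nonneg fun _ _ => sq_nonneg _
    have := mul_nonneg hc this
    linarith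
  refine integral_mono (hi _ (sq_nonneg m)) (by simpa using hi 1 zero_le_one) fun w => ?_
  apply Real.exp_le_exp.2
  have : 0 ≤ ∑ j, (w ᵥ* A) j ^ 2 := Finset.sum_nonneg fun _ _ => sq_nonneg _
  have hm2 : 1 ≤ m ^ 2 := one_le_pow₀ hm
  have := mul_le_mul_of_nonneg_right hm2 this
  linarith

lemma sum_tele (N : ℕ) : ∑ m ∈ Finset.range N, (4 / (π * (4 * ((m:ℝ)+1)^2 - 1))) = 4 / π * (N / (2 * N + 1)) := by
  have hp := Real.pi_pos
  induction N with
  | zero => simp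
  | succ k ih =>
    rw [Finset.sum_range_succ, ih]
    push_cast
    rw [show 4 * ((k:ℝ)+1)^2 - 1 = (2 * k + 1) * (2 * (k + 1) + 1) by ring]
    field_simp
    ring

lemma main_lower {dw dv : ℕ} (A : Matrix (Fin dw) (Fin dv) ℝ) (K : ℝ)
    (hK : ∀ m : ℝ, 1 ≤ m → ∫ p, Real.cos (m * (p.1 ⬝ᵥ (A *ᵥ p.2))) ∂((_root_.stdGaussian dw).prod (_root_.stdGaussian dv)) ≤ K) :
    4 / π ^ 2 * (1 - K) ≤ ∫ p, 2 / π * |Real.sin ((p.1 ⬝ᵥ (A *ᵥ p.2)) / 2)| ∂((_root_.stdGaussian dw).prod (_root_.stdGaussian dv)) := by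
  have hp := Real.pi_pos
  have hb := bil_cont A
  rw [integral_const_mul]
  set μ := (_root_.stdGaussian dw).prod (_root_.stdGaussian dv)
  have hN : ∀ N : ℕ, 4 / π * ((N:ℝ) / (2 * N + 1)) * (1 - K) ≤ ∫ p, |Real.sin ((p.1 ⬝ᵥ (A *ᵥ p.2)) / 2)| ∂μ := by
    intro N
    have hci : ∀ m : ℝ, Integrable (fun p : (Fin dw → ℝ) × (Fin dv → ℝ) => Real.cos (m * (p.1 ⬝ᵥ (A *ᵥ p.2)))) μ := fun m =>
      (Integrable.of_bound (C := 1) (Continuous.aestronglyMeasurable (by fun_prop))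
        (.of_forall fun v => Real.abs_cos_le_one _))
    have hti : ∀ m : ℕ, Integrable (fun p : (Fin dw → ℝ) × (Fin dv → ℝ) => (4 / (π * (4 * ((m:ℝ)+1)^2 - 1))) * (1 - Real.cos ((m+1) * (p.1 ⬝ᵥ (A *ᵥ p.2))))) μ := fun m =>
      ((integrable_const 1).sub (hci _)).const_mul _
    have h1 : ∫ p, ∑ m ∈ Finset.range N, (4 / (π * (4 * ((m:ℝ)+1)^2 - 1))) * (1 - Real.cos ((m+1) * (p.1 ⬝ᵥ (A *ᵥ p.2)))) ∂μ ≤ ∫ p, |Real.sin ((p.1 ⬝ᵥ (A *ᵥ p.2)) / 2)| ∂μ := by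
      refine integral_mono (integrable_finsetSum _ fun m _ => hti m) ?_ fun p => aux_lower _ N
      refine (Integrable.of_bound (C := 1) (Continuous.aestronglyMeasurable (by fun_prop))
        (.of_forall fun v => ?_))
      rw [Real.norm_eq_abs, abs_abs]; exact Real.abs_sin_le_one _
    refine le_trans ?_ h1
    rw [integral_finsetSum _ fun m _ => hti m, ← sum_tele, Finset.sum_mul]
    refine Finset.sum_le_sum fun m _ => ?_
    rw [integral_const_mul, integral_sub (integrable_const 1) (hci _)]
    have hm0 : (0:ℝ) ≤ m := by positivity
    have h2 : 0 < 4 * ((m:ℝ)+1)^2 - 1 := by nlinarith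
    have := hK (m + 1) (by linarith)
    simp only [integral_const, probReal_univ, smul_eq_mul, one_mul]
    gcongr
  have hlim : Filter.Tendsto (fun N : ℕ => 4 / π * ((N:ℝ) / (2 * N + 1)) * (1 - K)) Filter.atTop (nhds (4 / π * (1 / 2) * (1 - K))) := by
    refine Filter.Tendsto.mul_const _ (Filter.Tendsto.const_mul _ ?_)
    have h1 : Filter.Tendsto (fun N : ℕ => (1/2:ℝ) - 1/4 * (1 / ((N:ℝ) + 1/2))) Filter.atTop (nhds (1/2 - 1/4 * 0)) := by
      refine Filter.Tendsto.const_sub _ (Filter.Tendsto.const_mul _ ?_)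
      simp_rw [one_div]
      exact tendsto_inv_atTop_zero.comp (Filter.tendsto_atTop_add_const_right _ _ tendsto_natCast_atTop_atTop)
    rw [mul_zero, sub_zero] at h1
    refine h1.congr fun N => ?_
    have : (0:ℝ) ≤ N := by positivity
    field_simp
    ring
  have := ge_of_tendsto' hlim.neg (b := - ∫ p, |Real.sin ((p.1 ⬝ᵥ (A *ᵥ p.2)) / 2)| ∂μ) (fun N => neg_le_neg (hN N))
  have h3 := mul_le_mul_of_nonneg_left (neg_le_neg_iff.1 this) (show 0 ≤ 2 / π by positivity)
  refine le_trans (le_of_eq ?_) h3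
  field_simp

lemma final_num {dw dv : ℕ}
    (X Y : Matrix (Fin dw) (Fin dv) ℝ)
    (hX : Real.sqrt (∑ i, ∑ j, (X i j) ^ 2) ≤ 0.8)
    (hY : Real.sqrt (∑ i, ∑ j, (Y i j) ^ 2) ≤ 0.8)
    (hpsd : ((X - Y) * (X - Y)ᵀ).PosSemidef)
    (heig : ∃ i0 : Fin dw, (∀ i, hpsd.1.eigenvalues i ≤ hpsd.1.eigenvalues i0) ∧
      hpsd.1.eigenvalues i0 ≤ 0.28 * ∑ i ∈ Finset.univ.erase i0, hpsd.1.eigenvalues i) :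
    ∏ i, (√(1 + hpsd.1.eigenvalues i))⁻¹ ≤ (kg (X - Y)) ^ (0.79 : ℝ) := by
  obtain ⟨i0, hmax, hi0⟩ := heig
  have hn := hpsd.eigenvalues_nonneg
  have htr : ∑ i, ∑ j, (X - Y) i j ^ 2 = ∑ i, hpsd.1.eigenvalues i := by
    have := hpsd.1.trace_eq_sum_eigenvalues
    simp only [RCLike.ofReal_real_eq_id, id] at this
    rw [← this]
    simp [Matrix.trace, Matrix.mul_apply, sq]
  have hX2 : ∑ i, ∑ j, (X i j) ^ 2 ≤ 0.64 := by
    have := (Real.sqrt_le_left (by norm_num)).1 hX; norm_num at this ⊢; exact this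
  have hY2 : ∑ i, ∑ j, (Y i j) ^ 2 ≤ 0.64 := by
    have := (Real.sqrt_le_left (by norm_num)).1 hY; norm_num at this ⊢; exact this
  have hS : ∑ i, ∑ j, (X - Y) i j ^ 2 ≤ 2.56 := by
    have : ∑ i, ∑ j, (X - Y) i j ^ 2 ≤ ∑ i, ∑ j, (2 * X i j ^ 2 + 2 * Y i j ^ 2) := by
      refine Finset.sum_le_sum fun i _ => Finset.sum_le_sum fun j _ => ?_
      rw [Matrix.sub_apply]; nlinarith [sq_nonneg (X i j + Y i j)]
    simp only [Finset.sum_add_distrib, ← Finset.mul_sum] at this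
    norm_num at *; linarith
  have hle : hpsd.1.eigenvalues i0 ≤ 0.56 := by
    have := Finset.add_sum_erase Finset.univ hpsd.1.eigenvalues (Finset.mem_univ i0)
    rw [htr] at hS
    norm_num at *; linarith
  rw [kg, ← Real.exp_mul, htr, show -(∑ i, hpsd.1.eigenvalues i) / 2 * 0.79 = ∑ i, -(0.79 * hpsd.1.eigenvalues i / 2) by
    rw [Finset.sum_neg_distrib, ← Finset.sum_div, ← Finset.mul_sum]; ring, Real.exp_sum]
  refine Finset.prod_le_prod (fun i _ => by positivity) fun i _ => ?_
  rw [Real.exp_neg]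
  refine inv_anti₀ (Real.exp_pos _) ?_
  apply Real.le_sqrt_of_sq_le
  rw [← Real.exp_nat_mul]
  have := log_aux _ (hn i) ((hmax i).trans hle)
  refine le_trans (le_of_eq ?_) this
  congr 1
  push_cast; ring

/-- Lower bound on the expected Hamming distance under the assumptions of Lemma 1:
P(h(X) ≠ h(Y)) ≥ (4/π²)(1 − κ_g(X−Y)^0.79). -/
theorem expected_hamming_distance_lower {dw dv : ℕ} (hdw : 0 < dw) (hdv : 0 < dv)
    (X Y : Matrix (Fin dw) (Fin dv) ℝ)
    (hX : Real.sqrt (∑ i, ∑ j, (X i j) ^ 2) ≤ 0.8)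
    (hY : Real.sqrt (∑ i, ∑ j, (Y i j) ^ 2) ≤ 0.8)
    (hpsd : ((X - Y) * (X - Y)ᵀ).PosSemidef)
    -- λ₁ ≤ 0.28 · Σ_{i=2}^{d_w} λ_i : the largest eigenvalue is at most
    -- 0.28 times the sum of the remaining eigenvalues
    (heig : ∃ i0 : Fin dw, (∀ i, hpsd.1.eigenvalues i ≤ hpsd.1.eigenvalues i0) ∧
      hpsd.1.eigenvalues i0 ≤ 0.28 * ∑ i ∈ Finset.univ.erase i0, hpsd.1.eigenvalues i) :
    4 / π ^ 2 * (1 - (kg (X - Y)) ^ (0.79 : ℝ)) ≤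
      (hashLaw dw dv {p | hashBit X p ≠ hashBit Y p}).toReal := by
  rw [hashLaw_diff_eq]
  exact main_lower _ _ fun m hm => (cos_bound _ hpsd.1 hpsd.eigenvalues_nonneg m hm).trans
    (final_num X Y hX hY hpsd heig)
end

section
/- Let d_w, d_v be positive integers, let w ∈ ℝ^{d_w} and v₁, v₂ ∈ ℝ^{d_v} be independent random vectors with i.i.d. standard normal N(0,1) entries, let A be a real d_w × d_v matrix, and let m, n be positive integers. Then E[ cos(m·wᵀ A v₁)·cos(n·wᵀ A v₂) ] = det(I_{d_w} + (m² + n²)·A Aᵀ)^(−1/2) = κ_b(√(m² + n²)·A). -/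
open MeasureTheory ProbabilityTheory Matrix Real

lemma aux_cos {d : ℕ} (u : Fin d → ℝ) :
    ∫ v, Real.cos (u ⬝ᵥ v) ∂(_root_.stdGaussian d) = Real.exp (-(u ⬝ᵥ u) / 2) := by
  have h : ∫ v, Complex.exp ((u ⬝ᵥ v : ℝ) * Complex.I) ∂(_root_.stdGaussian d)
      = ((Real.exp (-(u ⬝ᵥ u) / 2) : ℝ) : ℂ) := by
    unfold _root_.stdGaussian dotProduct
    simp_rw [Complex.ofReal_sum, Finset.sum_mul, Complex.exp_sum]
    rw [integral_fintype_prod_eq_prod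
      (f := fun i (x : ℝ) => Complex.exp (((u i * x : ℝ) : ℂ) * Complex.I))]
    simp_rw [Complex.ofReal_mul, ← charFun_apply_real, charFun_gaussianReal]
    rw [← Complex.exp_sum, Complex.ofReal_exp]
    congr 1
    simp [Finset.sum_div, neg_div, sq]
  have hint : Integrable (fun v => Complex.exp ((u ⬝ᵥ v : ℝ) * Complex.I))
      (_root_.stdGaussian d) := by
    have : IsProbabilityMeasure (_root_.stdGaussian d) := by
      unfold _root_.stdGaussian; infer_instance
    refine Integrable.of_bound (C := 1) ?_ ?_
    · apply Continuous.aestronglyMeasurable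
      unfold dotProduct
      fun_prop
    · exact Filter.Eventually.of_forall fun v => (Complex.norm_exp_ofReal_mul_I _).le
  have h2 := integral_re hint
  rw [h] at h2
  rw [show RCLike.re ((Real.exp (-(u ⬝ᵥ u) / 2) : ℝ) : ℂ) = Real.exp (-(u ⬝ᵥ u) / 2) from
    Complex.ofReal_re _] at h2
  simpa [Complex.exp_ofReal_mul_I_re] using h2

lemma aux_one (a : ℝ) (ha : 0 ≤ a) :
    ∫ x, Real.exp (-(a * x ^ 2) / 2) ∂(gaussianReal 0 1) = (1 + a) ^ (-(1 / 2 : ℝ)) := by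
  rw [integral_gaussianReal_eq_integral_smul one_ne_zero]
  have : ∀ x : ℝ, gaussianPDFReal 0 1 x • Real.exp (-(a * x ^ 2) / 2)
      = (√(2 * π))⁻¹ * Real.exp (-((1 + a) / 2) * x ^ 2) := by
    intro x
    rw [gaussianPDFReal_def]
    simp only [NNReal.coe_one, smul_eq_mul, mul_one, sub_zero]
    rw [mul_assoc, ← Real.exp_add]
    congr 2
    ring
  simp_rw [this]
  rw [integral_const_mul, integral_gaussian, ← Real.sqrt_inv, ← Real.sqrt_mul (by positivity),
    Real.rpow_neg (by positivity), ← Real.sqrt_eq_rpow, ← Real.sqrt_inv]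
  congr 1
  field_simp

lemma aux_quad {d : ℕ} (S : Matrix (Fin d) (Fin d) ℝ) (hS : S.PosSemidef) :
    ∫ w, Real.exp (-(w ⬝ᵥ (S *ᵥ w)) / 2) ∂(_root_.stdGaussian d)
      = (Matrix.det (1 + S)) ^ (-(1 / 2 : ℝ)) := by
  have hH := hS.1
  have hU : (hH.eigenvectorUnitary : Matrix (Fin d) (Fin d) ℝ) *
      star (hH.eigenvectorUnitary : Matrix (Fin d) (Fin d) ℝ) = 1 :=
    Unitary.mul_star_self_of_mem hH.eigenvectorUnitary.2
  set b := hH.eigenvectorBasis with hb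
  have hrot : ∫ w, Real.exp (-(w ⬝ᵥ (S *ᵥ w)) / 2) ∂(_root_.stdGaussian d)
      = ∫ y : EuclideanSpace ℝ (Fin d), Real.exp (-(y.ofLp ⬝ᵥ (S *ᵥ y.ofLp)) / 2)
        ∂(ProbabilityTheory.stdGaussian (EuclideanSpace ℝ (Fin d))) := by
    rw [← map_pi_eq_stdGaussian, integral_map (by fun_prop)]
    · rfl
    · apply Continuous.aestronglyMeasurable
      unfold dotProduct mulVec dotProduct
      fun_prop
  rw [hrot, stdGaussian_eq_map_pi_orthonormalBasis b,
    integral_map (Measurable.aemeasurable (by fun_prop))]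
  · have hq : ∀ x : Fin d → ℝ, (∑ i, x i • b i).ofLp ⬝ᵥ (S *ᵥ (∑ i, x i • b i).ofLp)
        = ∑ i, hH.eigenvalues i * x i ^ 2 := by
      intro x
      have h1 : S *ᵥ (∑ i, x i • b i).ofLp
          = (∑ i, (hH.eigenvalues i * x i) • b i).ofLp := by
        simp only [WithLp.ofLp_sum, WithLp.ofLp_smul, Matrix.mulVec_sum, Matrix.mulVec_smul]
        refine Finset.sum_congr rfl fun i _ => ?_
        rw [hb, hH.mulVec_eigenvectorBasis, smul_smul, mul_comm]
      rw [h1]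
      have h2 := b.orthonormal.inner_sum (fun i => hH.eigenvalues i * x i) x Finset.univ
      rw [EuclideanSpace.inner_eq_star_dotProduct] at h2
      simp only [star_trivial] at h2
      rw [h2]
      refine Finset.sum_congr rfl fun i _ => ?_
      simp; ring
    simp_rw [hq]
    have : ∀ x : Fin d → ℝ, Real.exp (-(∑ i, hH.eigenvalues i * x i ^ 2) / 2)
        = ∏ i, Real.exp (-(hH.eigenvalues i * x i ^ 2) / 2) := by
      intro x
      rw [← Real.exp_sum, ← Finset.sum_neg_distrib, Finset.sum_div]
    simp_rw [this]
    rw [integral_fintype_prod_eq_prod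
      (f := fun i (x : ℝ) => Real.exp (-(hH.eigenvalues i * x ^ 2) / 2))]
    simp_rw [aux_one _ (hS.eigenvalues_nonneg _)]
    rw [Real.finsetProd_rpow _ _ (fun i _ => by linarith [hS.eigenvalues_nonneg i])]
    congr 1
    have hdet : (1 + S).det = ((hH.eigenvectorUnitary : Matrix (Fin d) (Fin d) ℝ) *
        (1 + diagonal hH.eigenvalues) * star (hH.eigenvectorUnitary : Matrix (Fin d) (Fin d) ℝ)).det := by
      congr 1
      conv_lhs => rw [hH.spectral_theorem, Unitary.conjStarAlgAut_apply]
      rw [mul_add, add_mul, mul_one, hU]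
      rfl
    rw [hdet, det_mul_right_comm, hU, one_mul, ← diagonal_one,
      diagonal_add, det_diagonal]
  · apply Continuous.aestronglyMeasurable
    unfold dotProduct mulVec dotProduct
    fun_prop

lemma aux_main {dw dv : ℕ} (A : Matrix (Fin dw) (Fin dv) ℝ) (a b : ℝ) :
    (∫ p : (Fin dw → ℝ) × (Fin dv → ℝ) × (Fin dv → ℝ),
        Real.cos (a * (p.1 ⬝ᵥ (A *ᵥ p.2.1))) * Real.cos (b * (p.1 ⬝ᵥ (A *ᵥ p.2.2)))
        ∂((_root_.stdGaussian dw).prod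
          ((_root_.stdGaussian dv).prod (_root_.stdGaussian dv)))) =
      (Matrix.det (1 + (a ^ 2 + b ^ 2) • (A * Aᵀ))) ^ (-(1 / 2 : ℝ)) := by
  have hP : ∀ d, IsProbabilityMeasure (_root_.stdGaussian d) := by
    intro d; unfold _root_.stdGaussian; infer_instance
  have hc : ∀ (c : ℝ) (w : Fin dw → ℝ),
      ∫ v, Real.cos (c * (w ⬝ᵥ (A *ᵥ v))) ∂(_root_.stdGaussian dv)
        = Real.exp (-(c ^ 2 * (w ⬝ᵥ ((A * Aᵀ) *ᵥ w))) / 2) := by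
    intro c w
    have : ∀ v, c * (w ⬝ᵥ (A *ᵥ v)) = (c • (w ᵥ* A)) ⬝ᵥ v := by
      intro v; rw [dotProduct_mulVec, smul_dotProduct, smul_eq_mul]
    simp_rw [this]
    rw [aux_cos, ← mulVec_mulVec, dotProduct_mulVec, mulVec_transpose, smul_dotProduct,
      dotProduct_smul, smul_eq_mul, smul_eq_mul, ← mul_assoc, sq]
  rw [integral_prod]
  · simp_rw [fun w : Fin dw → ℝ => integral_prod_mul (μ := _root_.stdGaussian dv)
      (ν := _root_.stdGaussian dv) (fun v => Real.cos (a * (w ⬝ᵥ (A *ᵥ v))))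
      (fun v => Real.cos (b * (w ⬝ᵥ (A *ᵥ v)))), hc, ← Real.exp_add]
    rw [← aux_quad]
    · congr 1
      ext w
      rw [smul_mulVec, dotProduct_smul, smul_eq_mul]
      congr 1
      ring
    · exact (Matrix.posSemidef_self_mul_conjTranspose A).smul (by positivity)
  · refine Integrable.of_bound (C := 1) ?_ ?_
    · apply Continuous.aestronglyMeasurable
      unfold dotProduct mulVec dotProduct
      fun_prop
    · refine Filter.Eventually.of_forall fun p => ?_
      rw [norm_mul]
      exact mul_le_one₀ (Real.abs_cos_le_one _) (norm_nonneg _) (Real.abs_cos_le_one _)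

/-- E[cos(m wᵀ A v₁)·cos(n wᵀ A v₂)] over independent Gaussian w, v₁, v₂ equals
det(I + (m²+n²) A Aᵀ)^(−1/2) = κ_b(√(m²+n²)·A). -/
theorem shared_projection_expectation {dw dv : ℕ} (hdw : 0 < dw) (hdv : 0 < dv)
    (A : Matrix (Fin dw) (Fin dv) ℝ) (m n : ℕ) (hm : 0 < m) (hn : 0 < n) :
    (∫ p : (Fin dw → ℝ) × (Fin dv → ℝ) × (Fin dv → ℝ),
        Real.cos ((m : ℝ) * (p.1 ⬝ᵥ (A *ᵥ p.2.1))) *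
          Real.cos ((n : ℝ) * (p.1 ⬝ᵥ (A *ᵥ p.2.2)))
        ∂((stdGaussian dw).prod ((stdGaussian dv).prod (stdGaussian dv)))) =
      (Matrix.det (1 + ((m : ℝ) ^ 2 + (n : ℝ) ^ 2) • (A * Aᵀ))) ^ (-(1 / 2 : ℝ)) ∧
    (∫ p : (Fin dw → ℝ) × (Fin dv → ℝ) × (Fin dv → ℝ),
        Real.cos ((m : ℝ) * (p.1 ⬝ᵥ (A *ᵥ p.2.1))) *
          Real.cos ((n : ℝ) * (p.1 ⬝ᵥ (A *ᵥ p.2.2)))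
        ∂((stdGaussian dw).prod ((stdGaussian dv).prod (stdGaussian dv)))) =
      kb (Real.sqrt ((m : ℝ) ^ 2 + (n : ℝ) ^ 2) • A) := by
  have h := aux_main A (m : ℝ) (n : ℝ)
  refine ⟨h, h.trans ?_⟩
  unfold kb
  rw [transpose_smul, Matrix.smul_mul, Matrix.mul_smul, smul_smul, Real.mul_self_sqrt (by positivity)]
end
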